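/- Let A be a Grothendieck abelian category and let M•, N• be objects of the bounded derived category D^b(A). Then the natural map Hom_{D(A)}(M•, N•) ⊗_ℤ ℚ → Hom_{D(A_ℚ)}(M•_ℚ, N•_ℚ) is an isomorphism, where A_ℚ is the Serre quotient of A by the subcategory of objects annihilated by some positive integer. -/

import Mathlib

open CategoryTheory CategoryTheory.Limits

universe w₁ w₂ v₁ v₂ u₁ u₂

/-- An object of a preadditive category is *torsion* if it is annihilated by some
positive integer, i.e. `n • 𝟙 M = 0` for some `n > 0`. -/
def IsTorsionObj {A : Type u₁} [Category.{v₁} A] [Preadditive A] (M : A) : Prop :=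
  ∃ n : ℕ, 0 < n ∧ (n : ℕ) • (𝟙 M) = 0

/-- The class of morphisms of an abelian category whose kernel and cokernel are
torsion objects.  The Serre quotient `A_ℚ` of `A` by the Serre subcategory of torsion
objects is the localization of `A` at this class of morphisms, and the quotient
functor `A → A_ℚ` is the corresponding localization functor. -/
def torsionIsos (A : Type u₁) [Category.{v₁} A] [Abelian A] : MorphismProperty A :=
  fun _ _ f => IsTorsionObj (kernel f) ∧ IsTorsionObj (cokernel f)

/-- A cochain complex is bounded if its components vanish outside a finite range. -/
def IsBoundedComplex {A : Type u₁} [Category.{v₁} A] [Abelian A]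
    (M : CochainComplex A ℤ) : Prop :=
  ∃ a b : ℤ, ∀ i : ℤ, (i < a ∨ b < i) → IsZero (M.X i)


section Helpers

variable {A : Type u₁} [Category.{v₁} A] [Abelian A] {B : Type u₂} [Category.{v₂} B] [Abelian B]

lemma uniform_aux (P : ℤ → ℕ → Prop) (hmul : ∀ i n m, 0 < m → P i n → P i (m * n))
    (a b : ℤ) (hout : ∀ i n, (i < a ∨ b < i) → P i n) (h : ∀ i, ∃ n, 0 < n ∧ P i n) :
    ∃ n, 0 < n ∧ ∀ i, P i n := by
  choose n hn hP using h
  refine ⟨∏ i ∈ Finset.Icc a b, n i, Finset.prod_pos fun i _ => hn i, fun i => ?_⟩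
  by_cases hi : i ∈ Finset.Icc a b
  · rw [← Finset.prod_erase_mul _ _ hi]
    exact hmul _ _ _ (Finset.prod_pos fun i _ => hn i) (hP i)
  · apply hout
    simp only [Finset.mem_Icc, not_and_or, not_le] at hi
    exact hi

/-- Key properties of the quotient functor. -/
structure RatData (Q : A ⥤ B) : Prop where
  zero : ∀ {X Y : A} (f : X ⟶ Y), Q.map f = 0 → ∃ n : ℕ, 0 < n ∧ n • f = 0
  surj : ∀ {X Y : A} (g : Q.obj X ⟶ Q.obj Y), ∃ n : ℕ, 0 < n ∧ ∃ f : X ⟶ Y, n • g = Q.map f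
  inj : ∀ (I : A), Injective I → Injective (Q.obj I)

lemma torsion_section {X Y : A} (s : X ⟶ Y) (hs : torsionIsos A s) :
    ∃ (n : ℕ) (t : Y ⟶ X), 0 < n ∧ t ≫ s = n • 𝟙 Y := by
  obtain ⟨⟨n, hn, h1⟩, ⟨m, hm, h2⟩⟩ := hs
  let u : Y ⟶ Abelian.image s := kernel.lift (cokernel.π s) (m • 𝟙 Y) (by
    rw [Preadditive.nsmul_comp, Category.id_comp, ← Category.comp_id (cokernel.π s),
      ← Preadditive.comp_nsmul, h2, comp_zero])
  have hu : u ≫ Abelian.image.ι s = m • 𝟙 Y := kernel.lift_ι _ _ _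
  let v : Abelian.coimage s ⟶ X := cokernel.desc (kernel.ι s) (n • 𝟙 X) (by
    rw [Preadditive.comp_nsmul, Category.comp_id, ← Category.id_comp (kernel.ι s),
      ← Preadditive.nsmul_comp, h1, zero_comp])
  have hv : Abelian.coimage.π s ≫ v = n • 𝟙 X := cokernel.π_desc _ _ _
  have hvs : v ≫ s = n • ((Abelian.coimageIsoImage s).hom ≫ Abelian.image.ι s) := by
    rw [← cancel_epi (Abelian.coimage.π s), reassoc_of% hv, Preadditive.comp_nsmul]
    simp
  refine ⟨n * m, u ≫ (Abelian.coimageIsoImage s).inv ≫ v, by positivity, ?_⟩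
  rw [Category.assoc, Category.assoc, hvs, Preadditive.comp_nsmul, Iso.inv_hom_id_assoc,
    Preadditive.comp_nsmul, hu, mul_smul]

lemma torsionIsos_nsmul (X : A) (n : ℕ) (hn : 0 < n) : torsionIsos A (n • 𝟙 X) := by
  refine ⟨⟨n, hn, ?_⟩, ⟨n, hn, ?_⟩⟩
  · rw [← cancel_mono (kernel.ι (n • 𝟙 X)), zero_comp, Preadditive.nsmul_comp, Category.id_comp]
    simpa using kernel.condition (n • 𝟙 X)
  · rw [← cancel_epi (cokernel.π (n • 𝟙 X)), comp_zero, Preadditive.comp_nsmul, Category.comp_id]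
    have := cokernel.condition (n • 𝟙 X)
    rwa [Preadditive.nsmul_comp, Category.id_comp] at this

lemma ratData (Q : A ⥤ B) [Q.Additive]
    (h1 : PreservesFiniteLimits Q) (h2 : PreservesFiniteColimits Q)
    (hQloc : Q.IsLocalization (torsionIsos A))
    (hQker : ∀ M : A, IsTorsionObj M ↔ IsZero (Q.obj M)) : RatData Q := by
  let P : ObjectProperty A := fun M => IsTorsionObj M
  have hP : P = ObjectProperty.inverseImage (IsZero (C := B)) Q := by
    ext M; exact hQker M
  have : P.IsSerreClass := by rw [hP]; infer_instance
  have hW : torsionIsos A = P.isoModSerre := rfl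
  have hloc : Q.IsLocalization P.isoModSerre := hQloc
  have zero : ∀ {X Y : A} (f : X ⟶ Y), Q.map f = 0 → ∃ n : ℕ, 0 < n ∧ n • f = 0 := by
    intro X Y f hf
    rw [ObjectProperty.SerreClassLocalization.map_eq_zero_iff Q P] at hf
    obtain ⟨n, hn, h⟩ := hf
    refine ⟨n, hn, ?_⟩
    rw [← Abelian.image.fac f, ← Preadditive.comp_nsmul,
      ← Category.id_comp (Abelian.image.ι f), ← Preadditive.nsmul_comp, h]
    simp
  have surj : ∀ {X Y : A} (g : Q.obj X ⟶ Q.obj Y), ∃ n : ℕ, 0 < n ∧ ∃ f : X ⟶ Y,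
      n • g = Q.map f := by
    intro X Y g
    obtain ⟨φ, hφ⟩ := Localization.exists_rightFraction Q P.isoModSerre g
    obtain ⟨n, t, hn, ht⟩ := torsion_section φ.s φ.hs
    refine ⟨n, hn, t ≫ φ.f, ?_⟩
    have h3 : Q.map φ.s ≫ g = Q.map φ.f := by
      rw [hφ]; exact φ.map_s_comp_map Q _
    rw [Q.map_comp, ← h3, ← Q.map_comp_assoc, ht, Functor.map_nsmul, Q.map_id,
      Preadditive.nsmul_comp, Category.id_comp]
  refine ⟨zero, surj, fun I hI => ⟨fun {X Y} g f hf => ?_⟩⟩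
  obtain ⟨X', Y', f', hf', ⟨e⟩⟩ := (ObjectProperty.SerreClassLocalization.mono_iff Q P f).1 hf
  let eX : Q.obj X' ≅ X := Arrow.leftFunc.mapIso e
  let eY : Q.obj Y' ≅ Y := Arrow.rightFunc.mapIso e
  have he : eX.hom ≫ f = Q.map f' ≫ eY.hom := e.hom.w
  obtain ⟨n, hn, k, hk⟩ := surj (eX.hom ≫ g)
  have : IsIso (Q.map (n • 𝟙 I)) := Localization.inverts Q (torsionIsos A) _
    (torsionIsos_nsmul I n hn)
  refine ⟨eY.inv ≫ Q.map (Injective.factorThru k f') ≫ inv (Q.map (n • 𝟙 I)), ?_⟩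
  have he' : f ≫ eY.inv = eX.inv ≫ Q.map f' := by
    rw [Iso.comp_inv_eq, Category.assoc, ← he, Iso.inv_hom_id_assoc]
  rw [reassoc_of% he', ← Q.map_comp_assoc, Injective.comp_factorThru, ← hk, ← Category.assoc,
    IsIso.comp_inv_eq, Functor.map_nsmul, Q.map_id, Preadditive.comp_nsmul,
    Preadditive.comp_nsmul]
  simp

variable (Q : A ⥤ B) [Q.Additive]

lemma lift_homotopy (hQ : RatData Q) {M L : CochainComplex A ℤ} (hM : IsBoundedComplex M)
    (φ : M ⟶ L) (h : Homotopy ((Q.mapHomologicalComplex (ComplexShape.up ℤ)).map φ) 0) :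
    ∃ n : ℕ, 0 < n ∧ n • (HomotopyCategory.quotient A (ComplexShape.up ℤ)).map φ = 0 := by
  obtain ⟨a, b, hab⟩ := hM
  obtain ⟨H, hH⟩ : ∃ H : ∀ i j, Q.obj (M.X i) ⟶ Q.obj (L.X j), ∀ i,
      Q.map (φ.f i) = Q.map (M.d i (i + 1)) ≫ H (i + 1) i +
        H i (i - 1) ≫ Q.map (L.d (i - 1) i) := by
    refine ⟨h.hom, fun i => ?_⟩
    have r1 : (ComplexShape.up ℤ).Rel (i - 1) i := by simp
    have r2 : (ComplexShape.up ℤ).Rel i (i + 1) := by simp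
    have hc := h.comm i
    rw [dNext_eq _ r2, prevD_eq _ r1, HomologicalComplex.zero_f, add_zero] at hc
    exact hc
  obtain ⟨n, hn, hk⟩ := uniform_aux
    (fun i n => ∀ j, j + 1 = i → ∃ k : M.X i ⟶ L.X j, n • H i j = Q.map k)
    (by
      intro i n m _ H1 j hj
      obtain ⟨k, hk⟩ := H1 j hj
      exact ⟨m • k, by rw [mul_smul, hk, Functor.map_nsmul]⟩)
    a b
    (by
      intro i n hi j _
      exact ⟨0, (Q.map_isZero (hab i hi)).eq_of_src _ _⟩)
    (by
      intro i
      obtain ⟨n, hn, k, hk⟩ := hQ.surj (H i (i - 1))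
      refine ⟨n, hn, fun j hj => ?_⟩
      obtain rfl : j = i - 1 := by lia
      exact ⟨k, hk⟩)
  choose k hk using hk
  let k' : ∀ i j, (ComplexShape.up ℤ).Rel j i → (M.X i ⟶ L.X j) := fun i j hij => k i j hij
  let E : M ⟶ L := n • φ - Homotopy.nullHomotopicMap' k'
  have hE : ∀ i, Q.map (E.f i) = 0 := by
    intro i
    have r1 : (ComplexShape.up ℤ).Rel (i - 1) i := by simp
    have r2 : (ComplexShape.up ℤ).Rel i (i + 1) := by simp
    have e1 : E.f i = n • φ.f i - (M.d i (i + 1) ≫ k (i + 1) i r2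
        + k i (i - 1) r1 ≫ L.d (i - 1) i) := by
      simp only [E, HomologicalComplex.sub_f_apply, HomologicalComplex.nsmul_f_apply,
        Homotopy.nullHomotopicMap'_f r1 r2, k']
    rw [e1, Q.map_sub, Functor.map_nsmul, Q.map_add, Q.map_comp, Q.map_comp,
      ← hk (i + 1) i r2, ← hk i (i - 1) r1, sub_eq_zero, Preadditive.comp_nsmul,
      Preadditive.nsmul_comp, ← smul_add]
    rw [hH]
  obtain ⟨m, hm, hmE⟩ := uniform_aux (fun i m => m • E.f i = 0)
    (by intro i n m _ H; rw [mul_smul, H, smul_zero]) a b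
    (by intro i n hi; exact (hab i hi).eq_of_src _ _)
    (fun i => hQ.zero _ (hE i))
  refine ⟨m * n, by positivity, ?_⟩
  have hmE' : m • E = 0 := by
    ext i
    simpa using hmE i
  have hz : (HomotopyCategory.quotient A (ComplexShape.up ℤ)).map
      (Homotopy.nullHomotopicMap' k') = 0 := by
    rw [HomotopyCategory.eq_of_homotopy _ _ (Homotopy.nullHomotopy' k'), Functor.map_zero]
  have := congrArg (HomotopyCategory.quotient A (ComplexShape.up ℤ)).map hmE'
  rwa [Functor.map_nsmul, Functor.map_sub, hz, sub_zero, Functor.map_nsmul, Functor.map_zero,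
    ← mul_smul] at this

lemma lift_map (hQ : RatData Q) {M L : CochainComplex A ℤ} (hM : IsBoundedComplex M)
    (ψ : (Q.mapHomologicalComplex (ComplexShape.up ℤ)).obj M ⟶
      (Q.mapHomologicalComplex (ComplexShape.up ℤ)).obj L) :
    ∃ (n : ℕ) (φ : M ⟶ L), 0 < n ∧
      n • ψ = (Q.mapHomologicalComplex (ComplexShape.up ℤ)).map φ := by
  obtain ⟨a, b, hab⟩ := hM
  obtain ⟨p, hp, hpd⟩ : ∃ p : ∀ i, Q.obj (M.X i) ⟶ Q.obj (L.X i), (∀ i, ψ.f i = p i) ∧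
      ∀ i, p i ≫ Q.map (L.d i (i + 1)) = Q.map (M.d i (i + 1)) ≫ p (i + 1) :=
    ⟨ψ.f, fun _ => rfl, fun i => ψ.comm i (i + 1)⟩
  obtain ⟨n, hn, hk⟩ := uniform_aux
    (fun i n => ∃ k : M.X i ⟶ L.X i, n • p i = Q.map k)
    (by
      rintro i n m _ ⟨k, hk⟩
      exact ⟨m • k, by rw [mul_smul, hk, Functor.map_nsmul]⟩)
    a b
    (by
      intro i n hi
      exact ⟨0, (Q.map_isZero (hab i hi)).eq_of_src _ _⟩)
    (fun i => hQ.surj (p i))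
  choose k hk using hk
  obtain ⟨m, hm, hmE⟩ := uniform_aux
    (fun i m => m • (k i ≫ L.d i (i + 1) - M.d i (i + 1) ≫ k (i + 1)) = 0)
    (by intro i n m _ H; rw [mul_smul, H, smul_zero]) a b
    (by intro i n hi; exact (hab i hi).eq_of_src _ _)
    (fun i => hQ.zero _ (by
      rw [Q.map_sub, Q.map_comp, Q.map_comp, ← hk, ← hk, Preadditive.nsmul_comp,
        Preadditive.comp_nsmul, sub_eq_zero, hpd]))
  refine ⟨m * n, { f := fun i => m • k i, comm' := ?_ }, by positivity, ?_⟩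
  · rintro i j hij
    obtain rfl : i + 1 = j := hij
    rw [Preadditive.nsmul_comp, Preadditive.comp_nsmul, ← sub_eq_zero, ← smul_sub]
    exact hmE i
  · ext i
    rw [HomologicalComplex.nsmul_f_apply, Functor.mapHomologicalComplex_map_f, mul_smul]
    have h1 : m • n • p i = Q.map (m • k i) := by rw [hk, Functor.map_nsmul]
    refine Eq.trans ?_ h1
    rw [hp]
    rfl

variable {C : Type u₁} [Category.{v₁} C] [Abelian C] [HasDerivedCategory.{w₁} C]

lemma Q_map_surj (M L : CochainComplex C ℤ) [L.IsKInjective]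
    (f : DerivedCategory.Q.obj M ⟶ DerivedCategory.Q.obj L) :
    ∃ φ : M ⟶ L, f = DerivedCategory.Q.map φ := by
  obtain ⟨g, hg⟩ := (CochainComplex.IsKInjective.Qh_map_bijective
    ((HomotopyCategory.quotient _ _).obj M) L).2
    ((DerivedCategory.quotientCompQhIso C).hom.app M ≫ f ≫
      (DerivedCategory.quotientCompQhIso C).inv.app L)
  obtain ⟨φ, rfl⟩ := (HomotopyCategory.quotient _ _).map_surjective g
  refine ⟨φ, ?_⟩
  rw [← cancel_epi ((DerivedCategory.quotientCompQhIso C).hom.app M),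
    ← DerivedCategory.quotientCompQhIso_hom_naturality, hg]
  simp

lemma Q_map_eq_zero_iff (M L : CochainComplex C ℤ) [L.IsKInjective] (φ : M ⟶ L) :
    DerivedCategory.Q.map φ = 0 ↔
      (HomotopyCategory.quotient C (ComplexShape.up ℤ)).map φ = 0 := by
  rw [← (CochainComplex.IsKInjective.Qh_map_bijective
    ((HomotopyCategory.quotient _ _).obj M) L).1.eq_iff, Functor.map_zero,
    ← cancel_epi ((DerivedCategory.quotientCompQhIso C).hom.app M),
    ← DerivedCategory.quotientCompQhIso_hom_naturality, comp_zero]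
  exact Preadditive.IsIso.comp_right_eq_zero _ _

end Helpers

/-- **Hom groups in the derived category of the Serre quotient `A_ℚ`**
(Lemma 5.10).  Let `A` be a Grothendieck abelian category (abelian, with small
colimits, exact filtered colimits (AB5) and a separator), and let `Q : A ⥤ B` be the
Serre quotient of `A` by the subcategory of objects annihilated by a positive integer
(recorded by: `Q` is additive and exact, and is the localization of `A` at the
morphisms with torsion kernel and cokernel, and kills exactly the torsion objects).
Let `Q'` be the induced functor on derived categories (recorded by the commutation
isomorphism `hcomm`).  Then for all bounded complexes `M•`, `N•` the natural map
`Hom_{D(A)}(M•, N•) ⊗ ℚ → Hom_{D(A_ℚ)}(M•_ℚ, N•_ℚ)` is an isomorphism; equivalently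
(as stated here): any `f` with `Q'.map f = 0` is killed by a positive integer, and any
`g : Q'(M•) ⟶ Q'(N•)` has a positive multiple of the form `Q'.map f`. -/
theorem hom_tensor_rat_iso_serre_quotient_derived
    {A : Type u₁} [Category.{v₁} A] [Abelian A] [HasColimits A]
    (hAB5 : ∀ (J : Type v₁) [SmallCategory J] [IsFiltered J],
      Nonempty (PreservesFiniteLimits (colim (J := J) (C := A))))
    (G : A) (hG : IsSeparator G)
    {B : Type u₂} [Category.{v₂} B] [Abelian B]
    (Q : A ⥤ B) [Q.Additive]
    (hQexact : Nonempty (PreservesFiniteLimits Q) ∧ Nonempty (PreservesFiniteColimits Q))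
    (hQloc : Q.IsLocalization (torsionIsos A))
    (hQker : ∀ M : A, IsTorsionObj M ↔ IsZero (Q.obj M))
    [HasDerivedCategory.{w₁} A] [HasDerivedCategory.{w₂} B]
    (Q' : DerivedCategory A ⥤ DerivedCategory B) [Q'.Additive]
    (hcomm : Q.mapHomologicalComplex (ComplexShape.up ℤ) ⋙ DerivedCategory.Q ≅
      (DerivedCategory.Q : CochainComplex A ℤ ⥤ DerivedCategory A) ⋙ Q')
    (M N : CochainComplex A ℤ) (hM : IsBoundedComplex M) (hN : IsBoundedComplex N) :
    (∀ f : DerivedCategory.Q.obj M ⟶ DerivedCategory.Q.obj N,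
      Q'.map f = 0 → ∃ n : ℕ, 0 < n ∧ (n : ℕ) • f = 0) ∧
    (∀ g : Q'.obj (DerivedCategory.Q.obj M) ⟶ Q'.obj (DerivedCategory.Q.obj N),
      ∃ (n : ℕ) (f : DerivedCategory.Q.obj M ⟶ DerivedCategory.Q.obj N),
        0 < n ∧ (n : ℕ) • g = Q'.map f) := by
  have hQ : RatData Q := by
    obtain ⟨⟨h1⟩, ⟨h2⟩⟩ := hQexact
    exact ratData Q h1 h2 hQloc hQker
  have : HasSeparator A := ⟨G, hG⟩
  have : AB5OfSize.{v₁, v₁} A := ⟨fun J _ _ => ⟨(hAB5 J).some⟩⟩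
  have : IsGrothendieckAbelian.{v₁} A := {}
  obtain ⟨a, b, hab⟩ := hN
  have : N.IsStrictlyGE a := (N.isStrictlyGE_iff a).2 fun i hi => hab i (Or.inl hi)
  obtain ⟨L, i, hi, hL, hLa⟩ :=
    CochainComplex.Plus.modelCategoryQuillen.exists_quasiIso_injective N a
  have : L.IsKInjective := CochainComplex.isKInjective_of_injective L a
  let QL : CochainComplex B ℤ := (Q.mapHomologicalComplex (ComplexShape.up ℤ)).obj L
  have : QL.IsStrictlyGE a := (QL.isStrictlyGE_iff a).2 fun j hj =>
    Q.map_isZero (L.isZero_of_isStrictlyGE a j hj)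
  have : ∀ j, Injective (QL.X j) := fun j => hQ.inj _ (hL j)
  have : QL.IsKInjective := CochainComplex.isKInjective_of_injective QL a
  have key : ∀ {X Y : CochainComplex A ℤ} (φ : X ⟶ Y), Q'.map (DerivedCategory.Q.map φ) =
      hcomm.inv.app X ≫ DerivedCategory.Q.map
        ((Q.mapHomologicalComplex (ComplexShape.up ℤ)).map φ) ≫ hcomm.hom.app Y := by
    intro X Y φ
    have := hcomm.hom.naturality φ
    dsimp at this
    rw [this]
    simp
  have hiso : IsIso (DerivedCategory.Q.map i) := inferInstance
  constructor
  · intro f hf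
    obtain ⟨φ, hφ⟩ := Q_map_surj M L (f ≫ DerivedCategory.Q.map i)
    have h0 : Q'.map (DerivedCategory.Q.map φ) = 0 := by
      rw [← hφ, Q'.map_comp, hf, zero_comp]
    rw [key] at h0
    have h1 : DerivedCategory.Q.map
        ((Q.mapHomologicalComplex (ComplexShape.up ℤ)).map φ) = 0 := by
      rw [← cancel_epi (hcomm.inv.app M), ← cancel_mono (hcomm.hom.app L)]
      simpa using h0
    rw [Q_map_eq_zero_iff _ QL] at h1
    obtain ⟨n, hn, h2⟩ := lift_homotopy Q hQ hM φ
      (HomotopyCategory.homotopyOfEq _ _ (by rw [h1, Functor.map_zero]))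
    refine ⟨n, hn, ?_⟩
    rw [← Functor.map_nsmul, ← Q_map_eq_zero_iff, Functor.map_nsmul, ← hφ,
      ← Preadditive.nsmul_comp] at h2
    rwa [← cancel_mono (DerivedCategory.Q.map i), zero_comp]
  · intro g
    obtain ⟨ψ, hψ⟩ := Q_map_surj _ QL
      (hcomm.hom.app M ≫ g ≫ Q'.map (DerivedCategory.Q.map i) ≫ hcomm.inv.app L)
    obtain ⟨n, φ, hn, hφ⟩ := lift_map Q hQ hM ψ
    refine ⟨n, DerivedCategory.Q.map φ ≫ inv (DerivedCategory.Q.map i), hn, ?_⟩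
    rw [← cancel_mono (Q'.map (DerivedCategory.Q.map i)), ← Q'.map_comp, Category.assoc,
      IsIso.inv_hom_id, Category.comp_id, key φ, ← hφ, Functor.map_nsmul, ← hψ]
    simp [Preadditive.comp_nsmul, Preadditive.nsmul_comp]
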